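/- arXiv:1606.01726 — 2 statements merged into one kernel-verified Lean document; each statement's English description precedes it below -/
import Mathlib

section
/- Let S be a semitopological monoid, H a complex Hilbert space, and π : S → C(H) a morphism of monoids that is continuous with respect to the strong* operator topology and is a factor representation. Then there exists a neighbourhood V of the unit 1 ∈ S such that for every amenable semitopological semigroup N and every continuous morphism of semigroups ι : N → S with ι(N) a normal subsemigroup of S and ι(N) ⊆ V, one has π(ι(n)) = 1_{B(H)} for every n ∈ N. -/
/-- `S` is a semitopological semigroup: multiplication is separately continuous. -/
def Semitopological (S : Type*) [TopologicalSpace S] [Mul S] : Prop :=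
  (∀ s : S, Continuous fun t => s * t) ∧ (∀ s : S, Continuous fun t => t * s)

/-- `f` is a left uniformly continuous bounded function on `S`: `f` is bounded,
continuous, and `s ↦ L_s f = f (s * ·)` is continuous into the sup-norm space. -/
def LUCb (S : Type*) [TopologicalSpace S] [Mul S] (f : S → ℂ) : Prop :=
  Continuous f ∧ (∃ C : ℝ, ∀ s : S, ‖f s‖ ≤ C) ∧
    ∀ s₀ : S, ∀ ε : ℝ, 0 < ε →
      ∀ᶠ s in nhds s₀, ∀ t : S, ‖f (s * t) - f (s₀ * t)‖ ≤ ε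

/-- `f` is a right uniformly continuous bounded function on `S`: `f` is bounded,
continuous, and `s ↦ R_s f = f (· * s)` is continuous into the sup-norm space. -/
def RUCb (S : Type*) [TopologicalSpace S] [Mul S] (f : S → ℂ) : Prop :=
  Continuous f ∧ (∃ C : ℝ, ∀ s : S, ‖f s‖ ≤ C) ∧
    ∀ s₀ : S, ∀ ε : ℝ, 0 < ε →
      ∀ᶠ s in nhds s₀, ∀ t : S, ‖f (t * s) - f (t * s₀)‖ ≤ ε

/-- `μ` is a left invariant mean on the set `D` of (complex bounded) functions on `S`:
it is linear, positive, has norm one with `μ(1) = 1`, and is invariant under all the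
left translation operators `L_t`. -/
def IsLIMeanOn {S : Type*} [Mul S] (D : Set (S → ℂ)) (μ : (S → ℂ) → ℂ) : Prop :=
  (∀ f ∈ D, ∀ g ∈ D, μ (f + g) = μ f + μ g) ∧
  (∀ (c : ℂ), ∀ f ∈ D, μ (c • f) = c * μ f) ∧
  (∀ f ∈ D, (∀ s, (f s).im = 0 ∧ 0 ≤ (f s).re) → (μ f).im = 0 ∧ 0 ≤ (μ f).re) ∧
  (∀ f ∈ D, ‖μ f‖ ≤ ⨆ s : S, ‖f s‖) ∧
  μ (fun _ => (1 : ℂ)) = 1 ∧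
  (∀ t : S, ∀ f ∈ D, μ (fun s => f (t * s)) = μ f)

/-- A semitopological semigroup is amenable if there is a left invariant mean on `LUC_b(S)`. -/
def AmenableSG (S : Type*) [TopologicalSpace S] [Mul S] : Prop :=
  ∃ μ : (S → ℂ) → ℂ, IsLIMeanOn {f | LUCb S f} μ

/-- `π` is a factor representation: the only closed linear subspaces invariant under
all operators from `π(S) ∪ π(S)'` are `{0}` and `H`. -/
def IsFactorRep {S : Type*} {H : Type*} [NormedAddCommGroup H] [InnerProductSpace ℂ H]
    (π : S → H →L[ℂ] H) : Prop :=
  ∀ K : Submodule ℂ H, IsClosed (K : Set H) →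
    (∀ s : S, ∀ x ∈ K, π s x ∈ K) →
    (∀ a : H →L[ℂ] H, (∀ s : S, a.comp (π s) = (π s).comp a) → ∀ x ∈ K, a x ∈ K) →
    K = ⊥ ∨ K = ⊤

/-- `π` is an irreducible representation: the only closed linear subspaces invariant
under all operators `π s` are `{0}` and `H`. -/
def IsIrredRep {S : Type*} {H : Type*} [NormedAddCommGroup H] [InnerProductSpace ℂ H]
    (π : S → H →L[ℂ] H) : Prop :=
  ∀ K : Submodule ℂ H, IsClosed (K : Set H) →
    (∀ s : S, ∀ x ∈ K, π s x ∈ K) →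
    K = ⊥ ∨ K = ⊤

/-- Alaoglu–Birkhoff: a family of contractions that leaves a nonempty closed convex set invariant
fixes the element of smallest norm in it. -/
theorem exists_mem_forall_fixed_of_contractions {N H : Type*} [NormedAddCommGroup H]
    [InnerProductSpace ℝ H] [CompleteSpace H] (T : N → H → H) (hT : ∀ n x, ‖T n x‖ ≤ ‖x‖)
    {C : Set H} (hne : C.Nonempty) (hcl : IsClosed C) (hconv : Convex ℝ C)
    (hinv : ∀ n, Set.MapsTo (T n) C C) : ∃ z ∈ C, ∀ n, T n z = z := by
  obtain ⟨z, hz, hmin⟩ := exists_norm_eq_iInf_of_complete_convex hne hcl.isComplete hconv 0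
  refine ⟨z, hz, fun n => ?_⟩
  have h := (norm_eq_iInf_iff_real_inner_le_zero hconv hz).1 hmin (T n z) (hinv n hz)
  rw [zero_sub, inner_neg_left, inner_sub_right, real_inner_self_eq_norm_sq] at h
  have hsq := norm_sub_sq_real (T n z) z
  rw [real_inner_comm] at hsq
  have hle : ‖T n z‖ ^ 2 ≤ ‖z‖ ^ 2 := by gcongr; exact hT n z
  have h0 : ‖T n z - z‖ ^ 2 = 0 := le_antisymm (by linarith) (sq_nonneg _)
  simpa [sub_eq_zero] using h0

/-- A semigroup of contractions that moves a vector by at most a distance `r` less than its norm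
has a nonzero common fixed vector. -/
theorem exists_ne_zero_forall_fixed_of_contractions {N H : Type*} [Nonempty N] [Mul N]
    [NormedAddCommGroup H] [InnerProductSpace ℝ H] [CompleteSpace H] (T : N → H →L[ℝ] H)
    (hmul : ∀ m n x, T (m * n) x = T m (T n x)) (hT : ∀ n, ‖T n‖ ≤ 1) {v : H} {r : ℝ}
    (hr : r < ‖v‖) (hv : ∀ n, ‖T n v - v‖ ≤ r) : ∃ z, z ≠ 0 ∧ ∀ n, T n z = z := by
  obtain ⟨z, hz, hfix⟩ := exists_mem_forall_fixed_of_contractions (fun n => T n)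
    (fun n x => by simpa using (T n).le_of_opNorm_le (hT n) x)
    (C := closure (convexHull ℝ (Set.range fun n => T n v)))
    ((Set.range_nonempty _).convexHull.closure) isClosed_closure (convex_convexHull ℝ _).closure
    (fun n => by
      refine Set.MapsTo.closure (fun x hx => ?_) (T n).continuous
      refine convexHull_min (t := T n ⁻¹' convexHull ℝ (Set.range fun n => T n v)) ?_
        ((convex_convexHull ℝ _).is_linear_preimage (T n).isLinear) hx
      rintro _ ⟨m, rfl⟩
      exact subset_convexHull ℝ _ ⟨n * m, hmul n m v⟩)
  refine ⟨z, ?_, hfix⟩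
  rintro rfl
  have hsub : closure (convexHull ℝ (Set.range fun n => T n v)) ⊆ Metric.closedBall v r := by
    refine closure_minimal (convexHull_min ?_ (convex_closedBall v r)) Metric.isClosed_closedBall
    rintro _ ⟨n, rfl⟩
    simpa [dist_eq_norm] using hv n
  have := hsub hz
  rw [Metric.mem_closedBall, dist_zero_left] at this
  exact this.not_gt hr

/-!
STATEMENT 2: For a strong*-continuous factor representation `π : S → C(H)` of a
semitopological monoid `S` there is a neighbourhood `V` of `1 ∈ S` such that every
amenable semitopological semigroup `N` mapped into `V` by a continuous normal morphism
`ι : N → S` satisfies `π(ι(n)) = 1` for all `n ∈ N`.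
-/

theorem stmt2 {S : Type u} [Monoid S] [TopologicalSpace S] (hS : Semitopological S)
    {H : Type v} [NormedAddCommGroup H] [InnerProductSpace ℂ H] [CompleteSpace H]
    (π : S → H →L[ℂ] H)
    (hπ1 : π 1 = 1)
    (hπm : ∀ s t : S, π (s * t) = (π s).comp (π t))
    (hπn : ∀ s : S, ‖π s‖ ≤ 1)
    (hπc : ∀ v : H, Continuous fun s => π s v)
    (hπc' : ∀ v : H, Continuous fun s => (ContinuousLinearMap.adjoint (π s)) v)
    (hfac : IsFactorRep π) :
    ∃ V ∈ nhds (1 : S),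
      ∀ (N : Type w) [Semigroup N] [TopologicalSpace N],
        Semitopological N → AmenableSG N →
        ∀ ι : N → S, Continuous ι → (∀ a b : N, ι (a * b) = ι a * ι b) →
          (∀ n₁ ∈ Set.range ι, ∀ n₂ ∈ Set.range ι, n₁ * n₂ ∈ Set.range ι) →
          (∀ s : S, (fun n => s * n) '' Set.range ι = (fun n => n * s) '' Set.range ι) →
          Set.range ι ⊆ V →
          ∀ n : N, π (ι n) = 1 := by
  rcases subsingleton_or_nontrivial H with hH | hH
  · exact ⟨Set.univ, Filter.univ_mem, fun _ _ _ _ _ _ _ _ _ _ _ _ =>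
      ContinuousLinearMap.ext fun _ => Subsingleton.elim _ _⟩
  obtain ⟨v, hv⟩ := exists_ne (0 : H)
  have hv' : 0 < ‖v‖ := norm_pos_iff.2 hv
  refine ⟨{s | ‖π s v - v‖ < ‖v‖ / 2}, ?_, ?_⟩
  · refine (isOpen_lt (((hπc v).sub continuous_const).norm) continuous_const).mem_nhds ?_
    simpa [hπ1] using hv
  intro N _ _ _ _ ι _ hι _ hnormal hV n₀
  have : Nonempty N := ⟨n₀⟩
  let _ : InnerProductSpace ℝ H := InnerProductSpace.complexToReal
  obtain ⟨z, hz0, hz⟩ := exists_ne_zero_forall_fixed_of_contractions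
    (fun n => (π (ι n)).restrictScalars ℝ) (fun m n x => by simp [hι, hπm])
    (fun n => by simpa using hπn (ι n)) (half_lt_self hv')
    (fun n => (hV ⟨n, rfl⟩ : ‖π (ι n) v - v‖ < ‖v‖ / 2).le)
  let K : Submodule ℂ H := ⨅ n, LinearMap.eqLocus (π (ι n)).toLinearMap LinearMap.id
  have hK : ∀ x, x ∈ K ↔ ∀ n, π (ι n) x = x := fun x => by simp [K]
  have hKcl : IsClosed (K : Set H) := by
    have : (K : Set H) = ⋂ n, {x | π (ι n) x = x} := by ext x; simp [hK]
    rw [this]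
    exact isClosed_iInter fun n => isClosed_eq (π (ι n)).continuous continuous_id
  have hKπ : ∀ s, ∀ x ∈ K, π s x ∈ K := fun s x hx => by
    refine (hK _).2 fun n => ?_
    obtain ⟨_, ⟨m, rfl⟩, hm⟩ := (hnormal s).ge ⟨ι n, ⟨n, rfl⟩, rfl⟩
    have h := congrArg (fun t => π t x) hm
    simpa [hπm, (hK x).1 hx m] using h.symm
  have hKcomm : ∀ a : H →L[ℂ] H, (∀ s, a.comp (π s) = (π s).comp a) → ∀ x ∈ K, a x ∈ K :=
    fun a ha x hx => by
      refine (hK _).2 fun n => ?_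
      have h := congrArg (fun f => f x) (ha (ι n))
      simpa [(hK x).1 hx n] using h.symm
  rcases hfac K hKcl hKπ hKcomm with h | h
  · exact absurd ((Submodule.eq_bot_iff K).1 h z ((hK z).2 hz)) hz0
  · exact ContinuousLinearMap.ext fun x => (hK x).1 (h ▸ Submodule.mem_top) n₀
end

section
/- Let S be a semitopological monoid with a filter basis 𝒩 of normal submonoids converging to the identity, and assume every element of 𝒩 with the topology induced from S is an amenable semitopological semigroup. Then for every factor representation π : S → C(H) that is continuous with respect to the strong* operator topology there exists N₀ ∈ 𝒩 satisfying the following equivalent conditions: (i) there exists a factor representation π₀ : S/N₀ → C(H), continuous with respect to the strong* operator topology, with π = π₀ ∘ p_{N₀}; (ii) N₀ ⊆ Ker π, i.e. π(n) = 1_{B(H)} for all n ∈ N₀. -/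
/-! Quotient of a monoid by a normal submonoid. -/

/-- The set `s • A = {s * a : a ∈ A}`. -/
def mulLeftSet {S : Type*} [Mul S] (s : S) (A : Set S) : Set S := (fun n => s * n) '' A

/-- The set `A • s = {a * s : a ∈ A}`. -/
def mulRightSet {S : Type*} [Mul S] (s : S) (A : Set S) : Set S := (fun n => n * s) '' A

/-- The equivalence relation `s ~ t ↔ sN = tN` associated with a subsemigroup `N`. -/
def cosetSetoid (S : Type*) [Mul S] (N : Set S) : Setoid S where
  r a b := mulLeftSet a N = mulLeftSet b N
  iseqv := ⟨fun _ => rfl, Eq.symm, Eq.trans⟩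

theorem mulLeftSet_comp {S : Type*} [Semigroup S] (a b : S) (A : Set S) :
    mulLeftSet a (mulLeftSet b A) = mulLeftSet (a * b) A := by
  simp only [mulLeftSet, Set.image_image, mul_assoc]

theorem mulLeftSet_mulRightSet {S : Type*} [Semigroup S] (a b : S) (A : Set S) :
    mulLeftSet a (mulRightSet b A) = mulRightSet b (mulLeftSet a A) := by
  simp only [mulLeftSet, mulRightSet, Set.image_image, mul_assoc]

theorem quot_mul_wd {S : Type*} [Monoid S] (N : Set S)
    (hnorm : ∀ s : S, mulLeftSet s N = mulRightSet s N)
    {a₁ a₂ b₁ b₂ : S} (ha : mulLeftSet a₁ N = mulLeftSet a₂ N)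
    (hb : mulLeftSet b₁ N = mulLeftSet b₂ N) :
    mulLeftSet (a₁ * b₁) N = mulLeftSet (a₂ * b₂) N := by
  calc mulLeftSet (a₁ * b₁) N = mulLeftSet a₁ (mulLeftSet b₁ N) := (mulLeftSet_comp _ _ _).symm
    _ = mulLeftSet a₁ (mulRightSet b₂ N) := by rw [hb, hnorm b₂]
    _ = mulRightSet b₂ (mulLeftSet a₁ N) := mulLeftSet_mulRightSet _ _ _
    _ = mulRightSet b₂ (mulLeftSet a₂ N) := by rw [ha]
    _ = mulLeftSet a₂ (mulRightSet b₂ N) := (mulLeftSet_mulRightSet _ _ _).symm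
    _ = mulLeftSet (a₂ * b₂) N := by rw [← hnorm b₂, mulLeftSet_comp]

/-- The quotient monoid `S/N` of a monoid `S` by a normal submonoid `N`. -/
def quotMonoid {S : Type*} [Monoid S] (N : Set S)
    (hnorm : ∀ s : S, mulLeftSet s N = mulRightSet s N) :
    Monoid (Quotient (cosetSetoid S N)) where
  mul := Quotient.map₂ (· * ·) (fun _ _ ha _ _ hb => quot_mul_wd N hnorm ha hb)
  one := Quotient.mk (cosetSetoid S N) 1
  mul_assoc a b c := by
    induction a using Quotient.inductionOn with | _ x =>
    induction b using Quotient.inductionOn with | _ y =>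
    induction c using Quotient.inductionOn with | _ z =>
    show Quotient.mk _ (x * y * z) = Quotient.mk _ (x * (y * z))
    rw [mul_assoc]
  one_mul a := by
    induction a using Quotient.inductionOn with | _ x =>
    show Quotient.mk _ (1 * x) = Quotient.mk _ x
    rw [one_mul]
  mul_one a := by
    induction a using Quotient.inductionOn with | _ x =>
    show Quotient.mk _ (x * 1) = Quotient.mk _ x
    rw [mul_one]

/-!
STATEMENT 3: Let `S` be a semitopological monoid with a filter basis `𝒩` of normal
submonoids converging to the identity, all amenable for the induced topology. Every
strong*-continuous factor representation `π : S → C(H)` admits `N₀ ∈ 𝒩` with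
(ii) `N₀ ⊆ Ker π`, and (i) `π` factors through the quotient monoid `S/N₀` via a
strong*-continuous factor representation `π₀`.
-/

/-- The multiplication induced on a subset closed under multiplication. -/
def subMul {S : Type*} [Mul S] (N : Set S) (h : ∀ a ∈ N, ∀ b ∈ N, a * b ∈ N) : Mul ↥N :=
  ⟨fun a b => ⟨a.1 * b.1, h a.1 a.2 b.1 b.2⟩⟩

/-- Matrix coefficients of a strong* continuous contractive representation are left uniformly
continuous. -/
theorem lucb_matrixCoeff {M : Type*} [TopologicalSpace M] [Mul M]
    {H : Type*} [NormedAddCommGroup H] [InnerProductSpace ℂ H] [CompleteSpace H]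
    {ρ : M → H →L[ℂ] H} (hm : ∀ s t : M, ρ (s * t) = (ρ s).comp (ρ t))
    (hn : ∀ s : M, ‖ρ s‖ ≤ 1) (hc : ∀ v : H, Continuous fun s => ρ s v)
    (hc' : ∀ v : H, Continuous fun s => (ContinuousLinearMap.adjoint (ρ s)) v) (x y : H) :
    LUCb M (fun m => inner ℂ y (ρ m x)) := by
  have hx (m : M) : ‖ρ m x‖ ≤ ‖x‖ := (ρ m).le_of_opNorm_le (hn m) x |>.trans (by simp)
  refine ⟨continuous_const.inner (hc x), ⟨‖y‖ * ‖x‖, fun m => ?_⟩, fun s₀ ε hε => ?_⟩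
  · exact (norm_inner_le_norm _ _).trans (by gcongr; exact hx m)
  · have hδ : 0 < ε / (‖x‖ + 1) := by positivity
    filter_upwards [(hc' y).continuousAt.eventually (Metric.ball_mem_nhds _ hδ)] with s hs t
    rw [dist_eq_norm] at hs
    have h (s : M) : inner ℂ y (ρ (s * t) x) =
        inner ℂ (ContinuousLinearMap.adjoint (ρ s) y) (ρ t x) := by
      rw [hm, ContinuousLinearMap.adjoint_inner_left]; rfl
    rw [h, h, ← inner_sub_left]
    calc _ ≤ ‖ContinuousLinearMap.adjoint (ρ s) y - ContinuousLinearMap.adjoint (ρ s₀) y‖ *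
          ‖ρ t x‖ := norm_inner_le_norm _ _
      _ ≤ ε / (‖x‖ + 1) * (‖x‖ + 1) := by
          gcongr
          exact (hx t).trans (by linarith)
      _ = ε := by field_simp

/-- An amenable semigroup of contractions moving `x` by at most `c` has a common fixed vector
within distance `c` of `x`. -/
theorem exists_fixed_vector_near {M : Type*} [TopologicalSpace M] [Mul M] [Nonempty M]
    (ham : AmenableSG M)
    {H : Type*} [NormedAddCommGroup H] [InnerProductSpace ℂ H] [CompleteSpace H]
    {ρ : M → H →L[ℂ] H} (hm : ∀ s t : M, ρ (s * t) = (ρ s).comp (ρ t))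
    (hn : ∀ s : M, ‖ρ s‖ ≤ 1) (hc : ∀ v : H, Continuous fun s => ρ s v)
    (hc' : ∀ v : H, Continuous fun s => (ContinuousLinearMap.adjoint (ρ s)) v)
    {x : H} {c : ℝ} (hx : ∀ m, ‖ρ m x - x‖ ≤ c) :
    ∃ v : H, (∀ m, ρ m v = v) ∧ ‖v - x‖ ≤ c := by
  obtain ⟨μ, hadd, hsmul, -, hnorm, hμ1, hinv⟩ := ham
  have hluc (y : H) := lucb_matrixCoeff hm hn hc hc' x y
  have hρx (m : M) : ‖ρ m x‖ ≤ ‖x‖ := (ρ m).le_of_opNorm_le (hn m) x |>.trans (by simp)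
  have hbound (y : H) : ‖μ (fun m => inner ℂ y (ρ m x))‖ ≤ ‖x‖ * ‖y‖ := by
    refine (hnorm _ (hluc y)).trans (ciSup_le fun m => ?_)
    rw [mul_comm]
    exact (norm_inner_le_norm _ _).trans (by gcongr; exact hρx m)
  let φ : H →L[ℂ] ℂ := LinearMap.mkContinuous
    { toFun := fun y => starRingEnd ℂ (μ (fun m => inner ℂ y (ρ m x)))
      map_add' := fun y z => by
        rw [← map_add, ← hadd _ (hluc y) _ (hluc z)]
        congr 2
        funext m
        exact inner_add_left _ _ _
      map_smul' := fun a y => by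
        rw [RingHom.id_apply, smul_eq_mul, ← Complex.conj_conj a, ← map_mul,
          ← hsmul _ _ (hluc y), Complex.conj_conj]
        congr 2
        funext m
        exact inner_smul_left _ _ _ }
    ‖x‖ (fun y => by simpa using hbound y)
  obtain ⟨v, hv⟩ : ∃ v : H, ∀ y, inner ℂ y v = μ (fun m => inner ℂ y (ρ m x)) := by
    refine ⟨(InnerProductSpace.toDual ℂ H).symm φ, fun y => ?_⟩
    rw [← inner_conj_symm, InnerProductSpace.toDual_symm_apply]
    exact Complex.conj_conj _
  refine ⟨v, fun t => ext_inner_left ℂ fun y => ?_, ?_⟩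
  · rw [← ContinuousLinearMap.adjoint_inner_left, hv, hv, ← hinv t _ (hluc y)]
    congr 1
    funext m
    rw [hm, ContinuousLinearMap.adjoint_inner_left]
    rfl
  · have hconst : LUCb M (fun _ => (1 : ℂ)) :=
      ⟨continuous_const, ⟨1, by simp⟩, fun _ ε hε => by simp [hε.le]⟩
    have hsmul_const (a : ℂ) : LUCb M (a • fun _ : M => (1 : ℂ)) :=
      ⟨continuous_const, ⟨‖a‖, by simp⟩, fun _ ε hε => by simp [hε.le]⟩
    have key (y : H) : ‖(inner ℂ y (v - x) : ℂ)‖ ≤ ‖y‖ * c := by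
      have hdiff : LUCb M
          ((fun m => inner ℂ y (ρ m x)) + (-inner ℂ y x : ℂ) • fun _ : M => (1 : ℂ)) := by
        obtain ⟨h1, ⟨C, hC⟩, h3⟩ := hluc y
        refine ⟨h1.add continuous_const, ⟨C + ‖inner ℂ y x‖, fun s => ?_⟩, fun s₀ ε hε => ?_⟩
        · refine (norm_add_le _ _).trans (add_le_add (hC s) (by simp))
        · filter_upwards [h3 s₀ ε hε] with s hs t
          simpa using hs t
      have heq : (inner ℂ y (v - x) : ℂ) =
          μ ((fun m => inner ℂ y (ρ m x)) + (-inner ℂ y x : ℂ) • fun _ : M => (1 : ℂ)) := by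
        rw [hadd _ (hluc y) _ (hsmul_const _), hsmul _ _ hconst, hμ1, inner_sub_right, hv]
        ring
      rw [heq]
      refine (hnorm _ hdiff).trans (ciSup_le fun m => ?_)
      have : ((fun m => inner ℂ y (ρ m x)) + (-inner ℂ y x : ℂ) • fun _ : M => (1 : ℂ)) m =
          inner ℂ y (ρ m x - x) := by
        simp [sub_eq_add_neg]
      rw [this]
      exact (norm_inner_le_norm _ _).trans (by gcongr; exact hx m)
    rcases eq_or_ne (v - x) 0 with h0 | h0
    · rw [h0, norm_zero]
      exact (norm_nonneg _).trans (hx (Classical.arbitrary M))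
    · have h := key (v - x)
      rw [inner_self_eq_norm_sq_to_K, norm_pow, RCLike.norm_ofReal, abs_norm, sq] at h
      exact le_of_mul_le_mul_left h (norm_pos_iff.mpr h0)

/-- The vectors fixed by `π n` for all `n ∈ N`. -/
def fixedSubmodule {S : Type*} {H : Type*} [NormedAddCommGroup H] [InnerProductSpace ℂ H]
    (π : S → H →L[ℂ] H) (N : Set S) : Submodule ℂ H where
  carrier := {x | ∀ n ∈ N, π n x = x}
  add_mem' hx hy n hn := by rw [map_add, hx n hn, hy n hn]
  zero_mem' n _ := map_zero _
  smul_mem' c x hx n hn := by rw [map_smul, hx n hn]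

theorem isClosed_fixedSubmodule {S : Type*} {H : Type*} [NormedAddCommGroup H]
    [InnerProductSpace ℂ H] (π : S → H →L[ℂ] H) (N : Set S) :
    IsClosed (fixedSubmodule π N : Set H) := by
  have : (fixedSubmodule π N : Set H) = ⋂ n ∈ N, {x | π n x = x} := by
    ext x
    simp [fixedSubmodule]
  rw [this]
  exact isClosed_biInter fun n _ => isClosed_eq (π n).continuous continuous_id

/-- For a factor representation, the vectors fixed by a normal subset are trivial or everything. -/
theorem IsFactorRep.fixedSubmodule_eq_bot_or_top {S : Type*} [Mul S] {H : Type*}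
    [NormedAddCommGroup H] [InnerProductSpace ℂ H] {π : S → H →L[ℂ] H} (hfac : IsFactorRep π)
    (hm : ∀ s t : S, π (s * t) = (π s).comp (π t)) {N : Set S}
    (hN : ∀ s : S, mulLeftSet s N = mulRightSet s N) :
    fixedSubmodule π N = ⊥ ∨ fixedSubmodule π N = ⊤ := by
  refine hfac _ (isClosed_fixedSubmodule π N) (fun s x hx n hn => ?_) (fun a ha x hx n hn => ?_)
  · obtain ⟨n', hn', h⟩ : n * s ∈ mulLeftSet s N := hN s ▸ ⟨n, hn, rfl⟩
    calc π n (π s x) = π (n * s) x := by rw [hm]; rfl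
      _ = π s (π n' x) := by rw [← h, hm]; rfl
      _ = π s x := by rw [hx n' hn']
  · calc π n (a x) = a (π n x) := (DFunLike.congr_fun (ha n) x).symm
      _ = a x := by rw [hx n hn]

theorem stmt3 {S : Type u} [Monoid S] [TopologicalSpace S] (hS : Semitopological S)
    {H : Type v} [NormedAddCommGroup H] [InnerProductSpace ℂ H] [CompleteSpace H]
    (𝒩 : Set (Set S)) (hne : 𝒩.Nonempty)
    (hone : ∀ N ∈ 𝒩, (1 : S) ∈ N)
    (hmul : ∀ N, ∀ hN : N ∈ 𝒩, ∀ a ∈ N, ∀ b ∈ N, a * b ∈ N)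
    (hnorm : ∀ N, ∀ hN : N ∈ 𝒩, ∀ s : S, mulLeftSet s N = mulRightSet s N)
    (hdir : ∀ N₁ ∈ 𝒩, ∀ N₂ ∈ 𝒩, ∃ N₃ ∈ 𝒩, N₃ ⊆ N₁ ∩ N₂)
    (hconv : ∀ V ∈ nhds (1 : S), ∃ N ∈ 𝒩, N ⊆ V)
    (hamen : ∀ N, ∀ hN : N ∈ 𝒩, @AmenableSG ↥N _ (subMul N (hmul N hN)))
    (π : S → H →L[ℂ] H)
    (hπ1 : π 1 = 1)
    (hπm : ∀ s t : S, π (s * t) = (π s).comp (π t))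
    (hπn : ∀ s : S, ‖π s‖ ≤ 1)
    (hπc : ∀ v : H, Continuous fun s => π s v)
    (hπc' : ∀ v : H, Continuous fun s => (ContinuousLinearMap.adjoint (π s)) v)
    (hfac : IsFactorRep π) :
    ∃ N₀ : Set S, ∃ hN₀ : N₀ ∈ 𝒩,
      -- (ii) `N₀ ⊆ Ker π`
      (∀ n ∈ N₀, π n = 1) ∧
      -- (i) `π` factors through the quotient monoid `S/N₀` via a strong*-continuous
      -- factor representation
      (letI := quotMonoid N₀ (hnorm N₀ hN₀)
       ∃ π₀ : Quotient (cosetSetoid S N₀) → H →L[ℂ] H,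
         π₀ 1 = 1 ∧
         (∀ a b : Quotient (cosetSetoid S N₀), π₀ (a * b) = (π₀ a).comp (π₀ b)) ∧
         (∀ q, ‖π₀ q‖ ≤ 1) ∧
         (∀ v : H, Continuous fun q => π₀ q v) ∧
         (∀ v : H, Continuous fun q => (ContinuousLinearMap.adjoint (π₀ q)) v) ∧
         IsFactorRep π₀ ∧
         π = π₀ ∘ Quotient.mk (cosetSetoid S N₀)) := by
  obtain ⟨N, hN, hker⟩ : ∃ N, ∃ _ : N ∈ 𝒩, ∀ n ∈ N, π n = 1 := by
    rcases subsingleton_or_nontrivial H with hH | hH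
    · obtain ⟨N, hN⟩ := hne
      exact ⟨N, hN, fun n _ => Subsingleton.elim _ _⟩
    obtain ⟨x, hx⟩ := exists_ne (0 : H)
    have hx' : 0 < ‖x‖ / 2 := by positivity
    obtain ⟨N, hN, hNV⟩ := hconv _
      ((hπc x).continuousAt.preimage_mem_nhds (Metric.ball_mem_nhds (π 1 x) hx'))
    refine ⟨N, hN, fun n hn => ?_⟩
    let := subMul N (hmul N hN)
    have : Nonempty N := ⟨⟨1, hone N hN⟩⟩
    obtain ⟨v, hv, hvx⟩ := exists_fixed_vector_near (hamen N hN) (ρ := fun n : N => π n)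
      (fun s t => hπm s t) (fun s => hπn s)
      (fun v => (hπc v).comp continuous_subtype_val)
      (fun v => (hπc' v).comp continuous_subtype_val) (x := x) (c := ‖x‖ / 2)
      (fun m => by
        have := hNV m.2
        simp only [Set.mem_preimage, mem_ball_iff_norm, hπ1] at this
        exact this.le)
    rcases hfac.fixedSubmodule_eq_bot_or_top hπm (hnorm N hN) with h | h
    · have hv0 : v ∈ fixedSubmodule π N := fun n hn => hv ⟨n, hn⟩
      rw [h, Submodule.mem_bot] at hv0
      rw [hv0, zero_sub, norm_neg] at hvx
      linarith
    · ext y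
      have hy : y ∈ fixedSubmodule π N := h ▸ Submodule.mem_top
      exact hy n hn
  refine ⟨N, hN, hker, ?_⟩
  have hlift (a b : S) (hab : mulLeftSet a N = mulLeftSet b N) : π a = π b := by
    obtain ⟨n, hn, h⟩ : a ∈ mulLeftSet b N := hab ▸ ⟨1, hone N hN, mul_one a⟩
    rw [← h, hπm, hker n hn]
    rfl
  refine ⟨Quotient.lift π hlift, hπ1, fun a b => ?_, fun q => ?_, fun v => ?_, fun v => ?_, ?_,
    rfl⟩
  · induction a using Quotient.inductionOn with | _ s =>
    induction b using Quotient.inductionOn with | _ t =>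
    exact hπm s t
  · induction q using Quotient.inductionOn with | _ s =>
    exact hπn s
  · exact isQuotientMap_quotient_mk'.continuous_iff.mpr (hπc v)
  · exact isQuotientMap_quotient_mk'.continuous_iff.mpr (hπc' v)
  · intro K hK hinv hcomm
    refine hfac K hK (fun s => hinv (Quotient.mk _ s)) fun a ha => hcomm a fun q => ?_
    induction q using Quotient.inductionOn with | _ s =>
    exact ha s
end
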